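/- (Subdifferential is determined by Gateaux derivatives on a dense subspace.) Let 𝓗 be a real Hilbert space and 𝓚 a dense subspace of 𝓗. Let 𝓕: 𝓗 → (−∞,+∞] be a proper, convex, strongly lower semicontinuous functional and let x belong to the effective domain of 𝓕. If there exists a linear functional T on 𝓚 such that lim_{t→0} (𝓕(x+ty) − 𝓕(x))/t = T(y) for every y ∈ 𝓚, then either ∂𝓕(x) = ∅ or ∂𝓕(x) = {v}, where v is the unique element of 𝓗 satisfying T(y) = ⟨v,y⟩ for every y ∈ 𝓚; in particular T is continuous on 𝓚 and v is its unique continuous extension to 𝓗. -/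

import Mathlib

open Filter
open scoped InnerProductSpace Topology

noncomputable section

/-- The (Fréchet) subdifferential of `F : 𝓗 → (-∞, +∞]` at `x`:
`∂F(x) = { v : liminf_{y → x} (F y − F x − ⟪v, y−x⟫)/‖y−x‖ ≥ 0 }`. -/
def subdiff {H : Type*} [NormedAddCommGroup H] [InnerProductSpace ℝ H]
    (F : H → EReal) (x : H) : Set H :=
  {v | (0 : EReal) ≤
    Filter.liminf
      (fun y => ((‖y - x‖⁻¹ : ℝ) : EReal) * (F y - F x - ((⟪v, y - x⟫_ℝ : ℝ) : EReal)))
      (nhdsWithin x {x}ᶜ)}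

theorem key_ineq {H : Type*} [NormedAddCommGroup H] [InnerProductSpace ℝ H]
    (F : H → EReal) (hnobot : ∀ z, F z ≠ ⊥) (x : H) (hx : F x ≠ ⊤) (v y : H) (τ : ℝ)
    (hv : v ∈ subdiff F x) (hy : y ≠ 0)
    (hT : Tendsto
      (fun t : ℝ => (F (x + t • y) - F x) * ((t⁻¹ : ℝ) : EReal))
      (nhdsWithin 0 {(0 : ℝ)}ᶜ) (nhds (τ : EReal))) : ⟪v, y⟫_ℝ ≤ τ := by
  by_contra! hlt
  obtain ⟨c, hc1, hc2⟩ := exists_between hlt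
  have hny : 0 < ‖y‖ := norm_pos_iff.mpr hy
  set ε : ℝ := (⟪v, y⟫_ℝ - c) / ‖y‖ with hε
  have hεpos : 0 < ε := div_pos (by linarith) hny
  have hv' : (0 : EReal) ≤ _ := hv
  have h0 : ((-ε : ℝ) : EReal) < 0 := by
    have : -ε < 0 := by linarith
    exact_mod_cast this
  have hev := Filter.eventually_lt_of_lt_liminf (lt_of_lt_of_le h0 hv')
  have htend : Tendsto (fun t : ℝ => x + t • y) (𝓝[>] 0) (𝓝[{x}ᶜ] x) := by
    apply tendsto_nhdsWithin_of_tendsto_nhds_of_eventually_within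
    · have hc : Continuous (fun t : ℝ => x + t • y) := by fun_prop
      have := hc.tendsto 0
      simp only [zero_smul, add_zero] at this
      exact this.mono_left nhdsWithin_le_nhds
    · filter_upwards [self_mem_nhdsWithin] with t ht
      have ht' : (0:ℝ) < t := ht
      simp [ht'.ne', hy]
  have h1 := htend.eventually hev
  have hle : (𝓝[>] (0:ℝ)) ≤ 𝓝[{(0:ℝ)}ᶜ] 0 :=
    nhdsWithin_mono _ (fun t ht => (show (0:ℝ) < t from ht).ne')
  have h2 := (hT.mono_left hle).eventually_lt_const
    (show (τ : EReal) < (c : EReal) by exact_mod_cast hc1)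
  obtain ⟨t, ⟨ha, hb⟩, ht⟩ := ((h1.and h2).and self_mem_nhdsWithin).exists
  have ht : (0:ℝ) < t := ht
  have hti : (0:ℝ) < t⁻¹ := inv_pos.mpr ht
  have hxb := hnobot x
  have hfb := hnobot (x + t • y)
  simp only [add_sub_cancel_left, norm_smul, inner_smul_right, Real.norm_eq_abs,
    abs_of_pos ht] at ha
  generalize F x = a at *
  generalize F (x + t • y) = f at *
  lift a to ℝ using ⟨hx, hxb⟩
  by_cases hft : f = ⊤
  · subst hft
    rw [EReal.top_sub_coe, EReal.top_mul_coe_of_pos hti] at hb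
    exact not_top_lt hb
  lift f to ℝ using ⟨hft, hfb⟩
  norm_cast at ha hb
  rw [← div_eq_mul_inv, div_lt_iff₀ ht] at hb
  rw [mul_comm, ← div_eq_mul_inv, lt_div_iff₀ (by positivity)] at ha
  have : ε * ‖y‖ = ⟪v, y⟫_ℝ - c := by rw [hε]; field_simp
  nlinarith

/-- Subdifferential is determined by Gateaux derivatives on a dense
subspace. -/
theorem subdiff_determined_by_gateaux
    {H : Type*} [NormedAddCommGroup H] [InnerProductSpace ℝ H] [CompleteSpace H]
    (K : Submodule ℝ H) (hK : Dense (K : Set H))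
    (F : H → EReal)
    (hproper : ∃ z, F z ≠ ⊤) (hnobot : ∀ z, F z ≠ ⊥)
    (hconv : ∀ z w : H, ∀ t : ℝ, 0 ≤ t → t ≤ 1 →
      F (t • z + (1 - t) • w) ≤ ((t : ℝ) : EReal) * F z + (((1 - t) : ℝ) : EReal) * F w)
    (hlsc : LowerSemicontinuous F)
    (x : H) (hx : F x ≠ ⊤)
    (T : K →ₗ[ℝ] ℝ)
    (hT : ∀ y : K, Tendsto
      (fun t : ℝ => (F (x + t • (y : H)) - F x) * ((t⁻¹ : ℝ) : EReal))
      (nhdsWithin 0 {(0 : ℝ)}ᶜ) (nhds ((T y : ℝ) : EReal))) :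
    subdiff F x = ∅ ∨
      ∃ v : H, subdiff F x = {v} ∧ (∀ y : K, T y = ⟪v, (y : H)⟫_ℝ) ∧
        (∀ v' : H, (∀ y : K, T y = ⟪v', (y : H)⟫_ℝ) → v' = v) ∧
        Continuous fun y : K => T y := by
  have heq : ∀ v ∈ subdiff F x, ∀ y : K, T y = ⟪v, (y : H)⟫_ℝ := by
    intro v hv y
    have hle : ∀ y : K, ⟪v, (y : H)⟫_ℝ ≤ T y := by
      intro y
      by_cases hy : (y : H) = 0
      · have : y = 0 := by exact_mod_cast hy
        simp [this]
      · exact key_ineq F hnobot x hx v y (T y) hv hy (hT y)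
    have h1 := hle y
    have h2 := hle (-y)
    simp only [map_neg, Submodule.coe_neg, inner_neg_right] at h2
    linarith
  have huniq : ∀ v v' : H, (∀ y : K, T y = ⟪v, (y : H)⟫_ℝ) →
      (∀ y : K, T y = ⟪v', (y : H)⟫_ℝ) → v' = v := by
    intro v v' h h'
    apply hK.eq_of_inner_left (𝕜 := ℝ)
    intro y hy
    exact (h' ⟨y, hy⟩).symm.trans (h ⟨y, hy⟩)
  rcases Set.eq_empty_or_nonempty (subdiff F x) with h | ⟨v, hv⟩
  · exact Or.inl h
  · refine Or.inr ⟨v, ?_, heq v hv, fun v' h' => huniq v v' (heq v hv) h', ?_⟩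
    · ext w
      constructor
      · intro hw
        exact huniq v w (heq v hv) (heq w hw)
      · rintro rfl
        exact hv
    · simp only [heq v hv]
      fun_prop
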